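/- Let G be a countable discrete amenable group, (V,‖·‖) a semi-normed real vector space, π: G → Isom(V) a uniformly bounded representation, W ⊆ V a subset, and U a subspace with L_W ⊆ U ⊆ cl(L), where L_W = span{w − π(g)w : w ∈ W, g ∈ G}, L = L_V, and cl(L) denotes the ‖·‖-closure of L. Then for every w in the ‖·‖-closure of the linear span of W: C_π⁻¹ · limsup_{F→G} ‖A_F w‖ ≤ ‖w + U‖_U ≤ inf_{F∈F(G)} ‖A_F w‖ ≤ limsup_{F→G} ‖A_F w‖. If in addition π is isometric (C_π = 1), then ‖w + U‖_U = limsup_{F→G} ‖A_F w‖ = inf_{F∈F(G)} ‖A_F w‖ for every such w. -/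

import Mathlib

open scoped Pointwise
open Filter

/-- The collection `F(G)` of non-empty finite subsets of `G`. -/
def FinG (G : Type*) := {F : Finset G // F.Nonempty}

section Defs

variable {G : Type*} [Group G] [DecidableEq G]

/-- `F` is `(K, δ)`-invariant: `|KF Δ F| ≤ δ|F|`. -/
def IsInv (K : Finset G) (δ : ℝ) (F : Finset G) : Prop :=
  ((symmDiff (K * F) F).card : ℝ) ≤ δ * (F.card : ℝ)

/-- `G` is amenable: for every `(K, δ)` there is a `(K, δ)`-invariant nonempty finite set. -/
def AmenableG (G : Type*) [Group G] [DecidableEq G] : Prop :=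
  ∀ K : Finset G, K.Nonempty → ∀ δ : ℝ, 0 < δ →
    ∃ F : Finset G, F.Nonempty ∧ IsInv K δ F

/-- `limsup_{F → G} φ(F) = inf_{(K,δ)} sup {φ(F) : F is (K,δ)-invariant}` (in the extended reals). -/
noncomputable def limsupG (φ : FinG G → ℝ) : EReal :=
  ⨅ (K : {K : Finset G // K.Nonempty}) (δ : {d : ℝ // 0 < d}),
    ⨆ F : {F : FinG G // IsInv K.1 δ.1 F.1}, (φ F.1 : EReal)

/-- `liminf_{F → G} φ(F) = sup_{(K,δ)} inf {φ(F) : F is (K,δ)-invariant}` (in the extended reals). -/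
noncomputable def liminfG (φ : FinG G → ℝ) : EReal :=
  ⨆ (K : {K : Finset G // K.Nonempty}) (δ : {d : ℝ // 0 < d}),
    ⨅ F : {F : FinG G // IsInv K.1 δ.1 F.1}, (φ F.1 : EReal)

/-- `lim_{F → G} φ(F) = L`. -/
def TendstoG (φ : FinG G → ℝ) (L : ℝ) : Prop :=
  ∀ ε : ℝ, 0 < ε → ∃ (K : Finset G) (δ : ℝ), K.Nonempty ∧ 0 < δ ∧
    ∀ F : FinG G, IsInv K δ F.1 → |φ F - L| < ε

/-- A (left) Følner sequence: `|F_n Δ g F_n| / |F_n| → 0` for every `g ∈ G`. -/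
def FolnerSeq (F : ℕ → FinG G) : Prop :=
  ∀ g : G, Filter.Tendsto
    (fun n => ((symmDiff ((F n).1.image (fun h => g * h)) (F n).1).card : ℝ) / ((F n).1.card : ℝ))
    Filter.atTop (nhds (0 : ℝ))

variable {V : Type*} [SeminormedAddCommGroup V] [NormedSpace ℝ V]

/-- The representation `π` is uniformly bounded with constant `C`. -/
def UnifBdd (π : G →* (V ≃L[ℝ] V)) (C : ℝ) : Prop :=
  ∀ (g : G) (v : V), ‖π g v‖ ≤ C * ‖v‖

/-- The representation `π` is isometric (`C_π = 1`). -/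
def IsIsometric (π : G →* (V ≃L[ℝ] V)) : Prop :=
  ∀ (g : G) (v : V), ‖π g v‖ = ‖v‖

/-- The ergodic sum `S_F v = Σ_{g ∈ F} π(g⁻¹) v`. -/
noncomputable def SF (π : G →* (V ≃L[ℝ] V)) (F : Finset G) (v : V) : V :=
  ∑ g ∈ F, π g⁻¹ v

/-- The ergodic average `A_F v = |F|⁻¹ • S_F v`. -/
noncomputable def AF (π : G →* (V ≃L[ℝ] V)) (F : Finset G) (v : V) : V :=
  (F.card : ℝ)⁻¹ • SF π F v

/-- Right translation `g • F = F g⁻¹` on nonempty finite subsets. -/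
def rT (g : G) (F : FinG G) : FinG G :=
  ⟨F.1.image (fun h => h * g⁻¹), F.2.image (fun h => h * g⁻¹)⟩

/-- `G`-equivariance of a set map: `π(g) φ(F) = φ(F g⁻¹)`. -/
def IsEquivariant (π : G →* (V ≃L[ℝ] V)) (φ : FinG G → V) : Prop :=
  ∀ (g : G) (F : FinG G), π g (φ F) = φ (rT g F)

/-- Boundedness of a set map: `sup_F ‖φ(F)‖/|F| < ∞`. -/
def IsBddMap (φ : FinG G → V) : Prop :=
  ∃ C : ℝ, ∀ F : FinG G, ‖φ F‖ ≤ C * (F.1.card : ℝ)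

/-- Membership in the space `M` of bounded `G`-equivariant set maps. -/
def MemM (π : G →* (V ≃L[ℝ] V)) (φ : FinG G → V) : Prop :=
  IsBddMap φ ∧ IsEquivariant π φ

/-- The sup seminorm `|||φ|||_sup = sup_F ‖φ(F)‖/|F|`. -/
noncomputable def supNorm (φ : FinG G → V) : ℝ :=
  ⨆ F : FinG G, ‖φ F‖ / (F.1.card : ℝ)

/-- The asymptotic seminorm `|||φ|||_G = limsup_{F → G} ‖φ(F)‖/|F|` (in the extended reals). -/
noncomputable def normG (φ : FinG G → V) : EReal :=
  limsupG (fun F => ‖φ F‖ / (F.1.card : ℝ))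

/-- Union of nonempty finite subsets. -/
def unionF (E F : FinG G) : FinG G :=
  ⟨E.1 ∪ F.1, E.2.inl⟩

/-- Additive set maps: `φ(E ⊔ F) = φ(E) + φ(F)` for disjoint `E, F`. -/
def IsAdditiveMap (φ : FinG G → V) : Prop :=
  ∀ E F : FinG G, Disjoint E.1 F.1 → φ (unionF E F) = φ E + φ F

/-- The additive set map `S(v)(F) = S_F v`. -/
noncomputable def Smap (π : G →* (V ≃L[ℝ] V)) (v : V) : FinG G → V :=
  fun F => SF π F.1 v

/-- The coboundary subspace `L_W = span{w − π(g)w : w ∈ W, g ∈ G}`. -/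
def cobSpan (π : G →* (V ≃L[ℝ] V)) (W : Set V) : Submodule ℝ V :=
  Submodule.span ℝ {x | ∃ w ∈ W, ∃ g : G, x = w - π g w}

/-- The coboundary subspace `L = L_V`. -/
def cobL (π : G →* (V ≃L[ℝ] V)) : Submodule ℝ V :=
  cobSpan π Set.univ

/-- The quotient seminorm `‖v + U‖_U = inf_{u ∈ U} ‖v + u‖`. -/
noncomputable def qnorm (U : Set V) (v : V) : ℝ :=
  ⨅ u : U, ‖v + u.1‖

/-- `v` is an additive realization of `φ`: `lim_{F→G} ‖φ(F)/|F| − A_F v‖ = 0`. -/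
def IsRealization (π : G →* (V ≃L[ℝ] V)) (φ : FinG G → V) (v : V) : Prop :=
  TendstoG (fun F => ‖(F.1.card : ℝ)⁻¹ • φ F - AF π F.1 v‖) 0

/-- `φ` is asymptotically additive: `inf_{ψ ∈ M_⊕} |||φ − ψ|||_G = 0`. -/
def AsympAdd (π : G →* (V ≃L[ℝ] V)) (φ : FinG G → V) : Prop :=
  (⨅ ψ : {ψ : FinG G → V // MemM π ψ ∧ IsAdditiveMap ψ}, normG (φ - ψ.1)) = (0 : EReal)

/-- `φ` is asymptotically additive relative to `W`. -/
def AsympAddRel (π : G →* (V ≃L[ℝ] V)) (W : Set V) (φ : FinG G → V) : Prop :=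
  (⨅ w : W, limsupG (fun F => ‖(F.1.card : ℝ)⁻¹ • φ F - AF π F.1 w.1‖)) = (0 : EReal)

/-- The quotient norm on `M_⊕ / N_⊕`. -/
noncomputable def qMplusN (π : G →* (V ≃L[ℝ] V)) (ψ : FinG G → V) : ℝ :=
  ⨅ η : {η : FinG G → V // MemM π η ∧ IsAdditiveMap η ∧ normG η = (0 : EReal)},
    supNorm (ψ + η.1)

end Defs

/-- The filter on `F(G)` along which `F → G`. -/
def folnerFilter (G : Type*) [Group G] [DecidableEq G] : Filter (FinG G) where
  sets := {S | ∃ (K : Finset G) (δ : ℝ), 0 < δ ∧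
    ∀ F : FinG G, (∀ h ∈ K, ((h • F.1 \ F.1).card : ℝ) ≤ δ * (F.1.card : ℝ)) → F ∈ S}
  univ_sets := ⟨∅, 1, one_pos, fun _ _ => trivial⟩
  sets_of_superset := by
    rintro S T ⟨K, δ, hδ, hS⟩ hST
    exact ⟨K, δ, hδ, fun F hF => hST (hS F hF)⟩
  inter_sets := by
    rintro S T ⟨K, δ, hδ, hS⟩ ⟨K', δ', hδ', hT⟩
    refine ⟨K ∪ K', min δ δ', lt_min hδ hδ', fun F hF => ⟨hS F fun h hh => ?_, hT F fun h hh => ?_⟩⟩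
    · refine (hF h (Finset.mem_union_left _ hh)).trans ?_
      gcongr
      exact min_le_left _ _
    · refine (hF h (Finset.mem_union_right _ hh)).trans ?_
      gcongr
      exact min_le_right _ _

section FolnerFilter

variable {G : Type*} [Group G] [DecidableEq G]

theorem IsInv.card_smul_sdiff_le {K F : Finset G} {δ : ℝ} (hF : IsInv K δ F) {h : G} (hh : h ∈ K) :
    ((h • F \ F).card : ℝ) ≤ δ * F.card := by
  refine le_trans ?_ hF
  norm_cast
  refine Finset.card_le_card fun x hx => ?_
  rw [Finset.mem_sdiff] at hx
  obtain ⟨y, hy, rfl⟩ := Finset.mem_smul_finset.1 hx.1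
  exact Finset.mem_symmDiff.2 (Or.inl ⟨Finset.mul_mem_mul hh hy, hx.2⟩)

theorem eventually_folnerFilter_card_sdiff_le (h : G) {δ : ℝ} (hδ : 0 < δ) :
    ∀ᶠ F in folnerFilter G, ((h • F.1 \ F.1).card : ℝ) ≤ δ * (F.1.card : ℝ) :=
  ⟨{h}, δ, hδ, fun _ hF => hF h (Finset.mem_singleton_self h)⟩

theorem exists_isInv_of_eventually_folnerFilter {p : FinG G → Prop}
    (hp : ∀ᶠ F in folnerFilter G, p F) :
    ∃ (K : Finset G) (δ : ℝ), K.Nonempty ∧ 0 < δ ∧ ∀ F : FinG G, IsInv K δ F.1 → p F := by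
  obtain ⟨K, δ, hδ, hK⟩ := hp
  exact ⟨insert 1 K, δ, Finset.insert_nonempty _ _, hδ, fun F hF => hK F fun h hh =>
    hF.card_smul_sdiff_le (Finset.mem_insert_of_mem hh)⟩

theorem limsupG_le_of_eventually {φ : FinG G → ℝ} {a : ℝ}
    (h : ∀ᶠ F in folnerFilter G, φ F ≤ a) : limsupG φ ≤ (a : EReal) := by
  obtain ⟨K, δ, hK, hδ, hF⟩ := exists_isInv_of_eventually_folnerFilter h
  refine (iInf₂_le (⟨K, hK⟩ : {K : Finset G // K.Nonempty}) (⟨δ, hδ⟩ : {d : ℝ // 0 < d})).trans ?_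
  exact iSup_le fun F => EReal.coe_le_coe_iff.2 (hF F.1 F.2)

theorem AmenableG.coe_le_limsupG (hG : AmenableG G) {φ : FinG G → ℝ} {a : ℝ} (h : ∀ F, a ≤ φ F) :
    (a : EReal) ≤ limsupG φ := by
  refine le_iInf₂ fun K δ => ?_
  obtain ⟨F, hF, hinv⟩ := hG K.1 K.2 δ.1 δ.2
  exact (EReal.coe_le_coe_iff.2 (h ⟨F, hF⟩)).trans
    (le_iSup (fun F : {F : FinG G // IsInv K.1 δ.1 F.1} => (φ F.1 : EReal)) ⟨⟨F, hF⟩, hinv⟩)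

end FolnerFilter

theorem qnorm_le {V : Type*} [SeminormedAddCommGroup V] {U : Set V} {u : V} (hu : u ∈ U) (v : V) :
    qnorm U v ≤ ‖v + u‖ :=
  ciInf_le ⟨0, by rintro _ ⟨u, rfl⟩; exact norm_nonneg _⟩ (⟨u, hu⟩ : U)

section Averages

variable {G : Type*} [Group G] {V : Type*} [SeminormedAddCommGroup V] [NormedSpace ℝ V]
  (π : G →* (V ≃L[ℝ] V))

theorem AF_add (F : Finset G) (v w : V) : AF π F (v + w) = AF π F v + AF π F w := by
  simp [AF, SF, Finset.sum_add_distrib]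

theorem AF_sub (F : Finset G) (v w : V) : AF π F (v - w) = AF π F v - AF π F w := by
  simp [AF, SF, Finset.sum_sub_distrib, smul_sub]

theorem AF_smul (F : Finset G) (c : ℝ) (v : V) : AF π F (c • v) = c • AF π F v := by
  simp [AF, SF, ← Finset.smul_sum, smul_comm c]

variable {π}

theorem UnifBdd.norm_sum_le {C : ℝ} (hπ : UnifBdd π C) (F : Finset G) (v : V) :
    ‖∑ g ∈ F, π g⁻¹ v‖ ≤ F.card * (C * ‖v‖) := by
  simpa using norm_sum_le_of_le F fun g _ => hπ g⁻¹ v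

theorem UnifBdd.norm_AF_le {C : ℝ} (hπ : UnifBdd π C) (F : FinG G) (v : V) :
    ‖AF π F.1 v‖ ≤ C * ‖v‖ := by
  have hF : (0 : ℝ) < F.1.card := by exact_mod_cast F.2.card_pos
  rw [AF, norm_smul, norm_inv, Real.norm_natCast, inv_mul_le_iff₀ hF]
  exact hπ.norm_sum_le F.1 v

theorem AF_sub_self_mem_cobSpan {W : Set V} (F : FinG G) {w : V} (hw : w ∈ Submodule.span ℝ W) :
    AF π F.1 w - w ∈ cobSpan π W := by
  induction hw using Submodule.span_induction with
  | mem x hx =>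
    have hF : (F.1.card : ℝ) ≠ 0 := by exact_mod_cast F.2.card_pos.ne'
    have h : AF π F.1 x - x = (F.1.card : ℝ)⁻¹ • ∑ g ∈ F.1, -(x - π g⁻¹ x) := by
      simp only [AF, SF, neg_sub, Finset.sum_sub_distrib, Finset.sum_const, smul_sub,
        ← Nat.cast_smul_eq_nsmul ℝ, inv_smul_smul₀ hF]
    rw [h]
    exact Submodule.smul_mem _ _ (Submodule.sum_mem _ fun g _ =>
      Submodule.neg_mem _ (Submodule.subset_span ⟨x, hx, g⁻¹, rfl⟩))
  | zero => simp [AF, SF]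
  | add x y _ _ hx hy =>
    rw [AF_add, add_sub_add_comm]
    exact Submodule.add_mem _ hx hy
  | smul c x _ hx =>
    rw [AF_smul, ← smul_sub]
    exact Submodule.smul_mem _ c hx

theorem UnifBdd.qnorm_le_norm_AF {C : ℝ} (hC : 0 ≤ C) (hπ : UnifBdd π C) {W : Set V}
    {U : Submodule ℝ V} (hWU : (cobSpan π W : Set V) ⊆ (U : Set V)) {w : V}
    (hw : w ∈ closure ((Submodule.span ℝ W : Submodule ℝ V) : Set V)) (F : FinG G) :
    qnorm (U : Set V) w ≤ ‖AF π F.1 w‖ := by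
  refine le_of_forall_pos_le_add fun ε hε => ?_
  have hM : 0 < C + 1 := by positivity
  obtain ⟨v, hv, hwv⟩ := Metric.mem_closure_iff.1 hw (ε / (C + 1)) (div_pos hε hM)
  rw [dist_eq_norm, lt_div_iff₀ hM] at hwv
  have h1 := qnorm_le (hWU (AF_sub_self_mem_cobSpan F hv)) w
  have h2 : w + (AF π F.1 v - v) = (w - v) - AF π F.1 (w - v) + AF π F.1 w := by
    rw [AF_sub]; abel
  rw [h2] at h1
  have h3 := norm_add_le ((w - v) - AF π F.1 (w - v)) (AF π F.1 w)
  have h4 := norm_sub_le (w - v) (AF π F.1 (w - v))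
  linarith [hπ.norm_AF_le F (w - v)]

variable [DecidableEq G]

theorem SF_apply_eq_SF_smul (F : Finset G) (h : G) (v : V) :
    SF π F (π h v) = SF π (h⁻¹ • F) v := by
  have hinj : Set.InjOn (fun g : G => h⁻¹ • g) F := (MulAction.injective h⁻¹).injOn
  rw [SF, SF, Finset.smul_finset_def, Finset.sum_image hinj]
  refine Finset.sum_congr rfl fun g _ => ?_
  rw [smul_eq_mul, mul_inv_rev, inv_inv, map_mul]
  rfl

theorem UnifBdd.norm_AF_sub_apply_le {C : ℝ} (hC : 0 ≤ C) (hπ : UnifBdd π C) (F : FinG G) (h : G)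
    (v : V) {δ : ℝ} (hF : ((h⁻¹ • F.1 \ F.1).card : ℝ) ≤ δ * F.1.card) :
    ‖AF π F.1 (v - π h v)‖ ≤ 2 * δ * (C * ‖v‖) := by
  have hpos : (0 : ℝ) < F.1.card := by exact_mod_cast F.2.card_pos
  have hcard : (F.1 \ h⁻¹ • F.1).card = (h⁻¹ • F.1 \ F.1).card :=
    Finset.card_sdiff_comm (Finset.card_smul_finset _ _).symm
  rw [AF_sub, AF, AF, ← smul_sub, SF_apply_eq_SF_smul, norm_smul, norm_inv, Real.norm_natCast,
    inv_mul_le_iff₀ hpos, SF, SF, ← Finset.sum_sdiff_sub_sum_sdiff]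
  have h1 := hπ.norm_sum_le (F.1 \ h⁻¹ • F.1) v
  have h2 := hπ.norm_sum_le (h⁻¹ • F.1 \ F.1) v
  rw [hcard] at h1
  have h3 := mul_le_mul_of_nonneg_right hF (mul_nonneg hC (norm_nonneg v))
  refine (norm_sub_le _ _).trans ?_
  linarith

theorem tendsto_AF_of_mem_cobL {C : ℝ} (hC : 0 ≤ C) (hπ : UnifBdd π C) {v : V}
    (hv : v ∈ cobL π) : Tendsto (fun F : FinG G => ‖AF π F.1 v‖) (folnerFilter G) (nhds 0) := by
  simp_rw [← tendsto_zero_iff_norm_tendsto_zero]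
  induction hv using Submodule.span_induction with
  | mem x hx =>
    obtain ⟨v, -, h, rfl⟩ := hx
    rw [tendsto_zero_iff_norm_tendsto_zero, Metric.tendsto_nhds]
    intro ε hε
    have hM : 0 < 2 * (C * ‖v‖ + 1) := by positivity
    filter_upwards [eventually_folnerFilter_card_sdiff_le h⁻¹ (div_pos hε hM)] with F hF
    rw [dist_zero_right, norm_norm]
    refine (hπ.norm_AF_sub_apply_le hC F h v hF).trans_lt ?_
    calc 2 * (ε / (2 * (C * ‖v‖ + 1))) * (C * ‖v‖)
        = ε * ((C * ‖v‖) / (C * ‖v‖ + 1)) := by field_simp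
      _ < ε * 1 := by
        gcongr
        rw [div_lt_one (by positivity)]
        linarith
      _ = ε := mul_one ε
  | zero => simpa [AF, SF] using tendsto_const_nhds
  | add x y _ _ hx hy => simpa [AF_add] using hx.add hy
  | smul c x _ hx => simpa [AF_smul] using hx.const_smul c

theorem eventually_norm_AF_lt_of_mem_closure_cobL {C : ℝ} (hC : 0 ≤ C) (hπ : UnifBdd π C) {v : V}
    (hv : v ∈ closure (cobL π : Set V)) {ε : ℝ} (hε : 0 < ε) :
    ∀ᶠ F in folnerFilter G, ‖AF π F.1 v‖ < ε := by
  have hM : 0 < 2 * (C + 1) := by positivity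
  obtain ⟨l, hl, hvl⟩ := Metric.mem_closure_iff.1 hv (ε / (2 * (C + 1))) (div_pos hε hM)
  rw [dist_eq_norm] at hvl
  filter_upwards [(tendsto_AF_of_mem_cobL hC hπ hl).eventually_lt_const (half_pos hε)] with F hF
  have h1 := hπ.norm_AF_le F (v - l)
  have h2 : C * ‖v - l‖ ≤ ε / 2 := by
    rw [lt_div_iff₀ hM] at hvl
    nlinarith [norm_nonneg (v - l)]
  rw [AF_sub] at h1
  linarith [norm_sub_norm_le (AF π F.1 v) (AF π F.1 l)]

theorem UnifBdd.limsupG_norm_AF_le {C : ℝ} (hC : 0 < C) (hπ : UnifBdd π C) {U : Submodule ℝ V}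
    (hU : (U : Set V) ⊆ closure (cobL π : Set V)) (w : V) :
    limsupG (fun F => ‖AF π F.1 w‖) ≤ ((C * qnorm (U : Set V) w : ℝ) : EReal) := by
  refine EReal.le_of_forall_lt_iff_le.1 fun a ha => limsupG_le_of_eventually ?_
  rw [EReal.coe_lt_coe_iff, ← lt_div_iff₀' hC] at ha
  obtain ⟨u, hu⟩ := exists_lt_of_ciInf_lt ha
  rw [lt_div_iff₀' hC] at hu
  filter_upwards [eventually_norm_AF_lt_of_mem_closure_cobL hC.le hπ (hU u.2) (sub_pos.2 hu)]
    with F hF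
  have h1 := hπ.norm_AF_le F (w + u.1)
  rw [AF_add] at h1
  linarith [norm_sub_le_norm_add (AF π F.1 w) (AF π F.1 u.1)]

theorem UnifBdd.mul_limsupG_le_qnorm_le_iInf_le_limsupG {C : ℝ} (hG : AmenableG G) (hC : 0 < C)
    (hπ : UnifBdd π C) {W : Set V} {U : Submodule ℝ V}
    (hWU : (cobSpan π W : Set V) ⊆ (U : Set V)) (hU : (U : Set V) ⊆ closure (cobL π : Set V))
    {w : V} (hw : w ∈ closure ((Submodule.span ℝ W : Submodule ℝ V) : Set V)) :
    ((C⁻¹ : ℝ) : EReal) * limsupG (fun F => ‖AF π F.1 w‖) ≤ ((qnorm (U : Set V) w : ℝ) : EReal) ∧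
      qnorm (U : Set V) w ≤ ⨅ F : FinG G, ‖AF π F.1 w‖ ∧
      ((⨅ F : FinG G, ‖AF π F.1 w‖ : ℝ) : EReal) ≤ limsupG (fun F => ‖AF π F.1 w‖) := by
  have : Nonempty (FinG G) := ⟨⟨{1}, Finset.singleton_nonempty 1⟩⟩
  refine ⟨?_, le_ciInf (hπ.qnorm_le_norm_AF hC.le hWU hw), hG.coe_le_limsupG fun F =>
    ciInf_le ⟨0, by rintro _ ⟨F, rfl⟩; exact norm_nonneg _⟩ F⟩
  refine (mul_le_mul_of_nonneg_left (hπ.limsupG_norm_AF_le hC hU w)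
    (EReal.coe_nonneg.2 (inv_nonneg.2 hC.le))).trans_eq ?_
  rw [← EReal.coe_mul, inv_mul_cancel_left₀ hC.ne']

end Averages

theorem statement6 {G : Type*} [Group G] [DecidableEq G] [Countable G]
    {V : Type*} [SeminormedAddCommGroup V] [NormedSpace ℝ V]
    (hG : AmenableG G) (π : G →* (V ≃L[ℝ] V)) (C : ℝ) (hC1 : 1 ≤ C) (hπ : UnifBdd π C)
    (W : Set V) (U : Submodule ℝ V)
    (hWU : (cobSpan π W : Set V) ⊆ (U : Set V))
    (hU : (U : Set V) ⊆ closure (cobL π : Set V)) :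
    (∀ w ∈ closure ((Submodule.span ℝ W : Submodule ℝ V) : Set V),
      ((C⁻¹ : ℝ) : EReal) * limsupG (fun F => ‖AF π F.1 w‖)
          ≤ ((qnorm (U : Set V) w : ℝ) : EReal) ∧
      qnorm (U : Set V) w ≤ ⨅ F : FinG G, ‖AF π F.1 w‖ ∧
      ((⨅ F : FinG G, ‖AF π F.1 w‖ : ℝ) : EReal) ≤ limsupG (fun F => ‖AF π F.1 w‖)) ∧
    (IsIsometric π →
      ∀ w ∈ closure ((Submodule.span ℝ W : Submodule ℝ V) : Set V),
        ((qnorm (U : Set V) w : ℝ) : EReal) = limsupG (fun F => ‖AF π F.1 w‖) ∧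
        qnorm (U : Set V) w = ⨅ F : FinG G, ‖AF π F.1 w‖) := by
  refine ⟨fun w hw => hπ.mul_limsupG_le_qnorm_le_iInf_le_limsupG hG (by positivity) hWU hU hw,
    fun hiso w hw => ?_⟩
  have hone : UnifBdd π 1 := fun g v => by rw [hiso, one_mul]
  obtain ⟨h1, h2, h3⟩ :=
    hone.mul_limsupG_le_qnorm_le_iInf_le_limsupG hG one_pos hWU hU hw
  rw [inv_one, EReal.coe_one, one_mul] at h1
  exact ⟨((EReal.coe_le_coe_iff.2 h2).trans h3).antisymm h1,
    h2.antisymm (EReal.coe_le_coe_iff.1 (h3.trans h1))⟩
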